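/- Let K be a field, Γ a linearly ordered commutative group with zero, and v : Valuation K Γ a valuation. Let d ≥ 2, fix vectors w : Fin (d−2) → (Fin d → K), and for a, b : Fin d → K let D(a,b) denote the determinant of the d×d matrix over K whose first d−2 columns are w(0), …, w(d−3) and whose last two columns are a and b. Then for all x, y, z, t : Fin d → K, among the three elements v(D(x,y))·v(D(z,t)), v(D(x,z))·v(D(y,t)), v(D(x,t))·v(D(y,z)) of Γ, the maximum is attained at least twice (at least two of the three equal their maximum). -/

import Mathlib

/-- Given `d ≥ 2`, fixed columns `w 0, …, w (d-3)` and two further columns `a`, `b` in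
`Fin d → K`, this is the determinant of the `d × d` matrix whose columns are
`w 0, …, w (d-3), a, b` in this order. -/
def plueckerMinor {K : Type*} [Field K] {d : ℕ} (hd : 2 ≤ d)
    (w : Fin (d - 2) → (Fin d → K)) (a b : Fin d → K) : K :=
  Matrix.det (Matrix.of fun (i j : Fin d) =>
    Fin.append w ![a, b] (Fin.cast (Nat.sub_add_cancel hd).symm j) i)

/-- At least two of `a`, `b`, `c` are equal to their maximum. -/
def MaxAttainedTwice {Γ : Type*} [LinearOrder Γ] (a b c : Γ) : Prop :=
  (a = max a (max b c) ∧ b = max a (max b c)) ∨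
  (a = max a (max b c) ∧ c = max a (max b c)) ∨
  (b = max a (max b c) ∧ c = max a (max b c))

/-- If three elements of a valued ring sum to zero, then the maximum of their valuations is
attained at least twice. -/
theorem MaxAttainedTwice.of_add_eq_zero {R Γ : Type*} [Ring R]
    [LinearOrderedCommGroupWithZero Γ] (v : Valuation R Γ) {p q r : R} (h : p + q + r = 0) :
    MaxAttainedTwice (v p) (v q) (v r) := by
  have hp : v p ≤ max (v q) (v r) := by
    rw [show p = -(q + r) from
      eq_neg_of_add_eq_zero_left (by rw [← h]; abel), v.map_neg]
    exact v.map_add q r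
  have hq : v q ≤ max (v p) (v r) := by
    rw [show q = -(p + r) from
      eq_neg_of_add_eq_zero_left (by rw [← h]; abel), v.map_neg]
    exact v.map_add p r
  have hr : v r ≤ max (v p) (v q) := by
    rw [show r = -(p + q) from eq_neg_of_add_eq_zero_right h, v.map_neg]
    exact v.map_add p q
  unfold MaxAttainedTwice
  grind

/-- The three-term Plücker relation. -/
theorem plueckerMinor_mul_plueckerMinor {K : Type*} [Field K] {d : ℕ} (hd : 2 ≤ d)
    (w : Fin (d - 2) → (Fin d → K)) (x y z t : Fin d → K) :
    plueckerMinor hd w x y * plueckerMinor hd w z t =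
      plueckerMinor hd w z y * plueckerMinor hd w x t +
        plueckerMinor hd w x z * plueckerMinor hd w y t := by
  obtain ⟨n, rfl⟩ := Nat.exists_eq_add_of_le' hd
  change Fin n → (Fin (n + 2) → K) at w
  let M (a b : Fin (n + 2) → K) : Matrix (Fin (n + 2)) (Fin (n + 2)) K :=
    Matrix.of fun i j => Fin.append w ![a, b] j i
  have hM (a b) : plueckerMinor hd w a b = (M a b).det := rfl
  have cramer_left (a b c) : (M a b).cramer c (Fin.natAdd n 0) = (M c b).det := by
    rw [Matrix.cramer_apply]
    congr 1
    ext i j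
    refine Fin.addCases (fun j => ?_) (fun j => ?_) j
    · simp [M, Fin.ext_iff, j.2.ne]
    · fin_cases j <;> simp [M, Fin.ext_iff, Fin.append_right]
  have cramer_right (a b c) : (M a b).cramer c (Fin.natAdd n 1) = (M a c).det := by
    rw [Matrix.cramer_apply]
    congr 1
    ext i j
    refine Fin.addCases (fun j => ?_) (fun j => ?_) j
    · have := j.2
      simp [M, Matrix.updateCol_apply, Fin.ext_iff]
      omega
    · fin_cases j <;> simp [M, Fin.ext_iff, Fin.append_right]
  have det_w (j b) : (M (w j) b).det = 0 :=
    Matrix.det_zero_of_column_eq (i := Fin.castAdd 2 j) (j := Fin.natAdd n 0)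
      (by simp [Fin.ext_iff, j.2.ne]) fun i => by
        simp only [M, Matrix.of_apply, Fin.append_left, Fin.append_right]
        rfl
  have key := congrArg (fun u => (M 0 t).cramer u (Fin.natAdd n 0))
    (Matrix.mulVec_cramer (M x y) z)
  have col_w (j) : (M x y).col (Fin.castAdd 2 j) = w j := by
    ext i
    simp [M]
  have col_x : (M x y).col (Fin.natAdd n 0) = x := by
    ext i; simp only [M, Matrix.col_apply, Matrix.of_apply, Fin.append_right]
    rfl
  have col_y : (M x y).col (Fin.natAdd n 1) = y := by
    ext i; simp only [M, Matrix.col_apply, Matrix.of_apply, Fin.append_right]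
    rfl
  have hsum : (M x y).mulVec ((M x y).cramer z) =
      ∑ j, (M x y).cramer z j • (M x y).col j := by
    ext i
    simp [Matrix.mulVec, dotProduct, mul_comm]
  rw [hsum, Fin.sum_univ_add, Fin.sum_univ_two] at key
  simp only [map_add, map_sum, map_smul, Pi.add_apply, Finset.sum_apply, Pi.smul_apply,
    smul_eq_mul, col_w, col_x, col_y] at key
  simp only [cramer_left, cramer_right, det_w, mul_zero, Finset.sum_const_zero,
    zero_add] at key
  simp only [hM]
  exact key.symm

/-- Plücker coordinates are antisymmetric in the two free columns. -/
theorem plueckerMinor_swap {K : Type*} [Field K] {d : ℕ} (hd : 2 ≤ d)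
    (w : Fin (d - 2) → (Fin d → K)) (a b : Fin d → K) :
    plueckerMinor hd w a b = -plueckerMinor hd w b a := by
  obtain ⟨n, rfl⟩ := Nat.exists_eq_add_of_le' hd
  change Fin n → (Fin (n + 2) → K) at w
  have hne : (Fin.natAdd n 0 : Fin (n + 2)) ≠ Fin.natAdd n 1 := by simp [Fin.ext_iff]
  have h := Matrix.det_permute' (Equiv.swap (Fin.natAdd n 0) (Fin.natAdd n 1))
    (Matrix.of fun i j : Fin (n + 2) => Fin.append w ![b, a] j i)
  rw [Equiv.Perm.sign_swap hne] at h
  simp only [Units.val_neg, Units.val_one, Int.cast_neg, Int.cast_one, neg_one_mul] at h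
  refine Eq.trans ?_ h
  change Matrix.det (Matrix.of fun i j : Fin (n + 2) => Fin.append w ![a, b] j i) = _
  congr 1
  ext i j
  refine Fin.addCases (fun j => ?_) (fun j => ?_) j
  · have := j.2
    simp only [Matrix.submatrix_apply, Matrix.of_apply, id]
    rw [Equiv.swap_apply_of_ne_of_ne (by simp [Fin.ext_iff]; omega)
      (by simp [Fin.ext_iff]; omega)]
    simp
  · fin_cases j
    · change _ = Fin.append w ![b, a] (Equiv.swap _ _ (Fin.natAdd n 0)) i
      rw [Equiv.swap_apply_left]
      simp only [Matrix.of_apply, Fin.append_right]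
      rfl
    · change _ = Fin.append w ![b, a] (Equiv.swap _ _ (Fin.natAdd n 1)) i
      rw [Equiv.swap_apply_right]
      simp only [Matrix.of_apply, Fin.append_right]
      rfl

/-- Valuations of Plücker coordinates of any plane over a valued field satisfy the
three-term tropical Plücker relations: the Dressian contains the tropical Grassmannian
over any field ("How to draw tropical planes", Section 2). -/
theorem valuation_pluecker_max_attained_twice
    {K : Type*} [Field K] {Γ : Type*} [LinearOrderedCommGroupWithZero Γ]
    (v : Valuation K Γ) {d : ℕ} (hd : 2 ≤ d)
    (w : Fin (d - 2) → (Fin d → K)) (x y z t : Fin d → K) :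
    MaxAttainedTwice
      (v (plueckerMinor hd w x y) * v (plueckerMinor hd w z t))
      (v (plueckerMinor hd w x z) * v (plueckerMinor hd w y t))
      (v (plueckerMinor hd w x t) * v (plueckerMinor hd w y z)) := by
  have h := plueckerMinor_mul_plueckerMinor hd w x y z t
  rw [plueckerMinor_swap hd w z y] at h
  have h_sum : plueckerMinor hd w x y * plueckerMinor hd w z t +
      -(plueckerMinor hd w x z * plueckerMinor hd w y t) +
      plueckerMinor hd w x t * plueckerMinor hd w y z = 0 := by
    linear_combination h
  simpa only [Valuation.map_neg, map_mul] using MaxAttainedTwice.of_add_eq_zero v h_sum
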